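/- From hierarchical definitions to TSLPs: let Σ be a ranked alphabet. There is a constant C (depending only on Σ) such that the following holds: if t ∈ T(Σ) is a term and (T,P) is a hierarchical definition in normal form of the Σ-labelled tree T corresponding to t, where P has depth d and m pairwise inequivalent patterns, then there exists a tree straight-line program G over Σ in normal form with val(G) = t, of size at most C·m and depth at most C·d. -/

import Mathlib

/-- Terms over a ranked alphabet `σ` with arity function `ar`. -/
inductive RTerm (σ : Type) (ar : σ → ℕ) : Type
  | node (f : σ) (args : Fin (ar f) → RTerm σ ar) : RTerm σ ar

/-- The subterm of `t` at position `l` (if it exists). -/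
def RTerm.subAt {σ : Type} {ar : σ → ℕ} : RTerm σ ar → List ℕ → Option (RTerm σ ar)
  | t, [] => some t
  | .node f args, i :: l => if h : i < ar f then (args ⟨i, h⟩).subAt l else none

/-- The set of node positions of (the tree corresponding to) the term `t`. -/
def RTerm.pos {σ : Type} {ar : σ → ℕ} (t : RTerm σ ar) : Set (List ℕ) :=
  {l | (t.subAt l).isSome}

/-- The label (symbol of `σ`) of the node of `t` at position `l`. -/
def RTerm.labelAt {σ : Type} {ar : σ → ℕ} (t : RTerm σ ar) (l : List ℕ) :
    Option σ :=
  (t.subAt l).map fun s => match s with | .node f _ => f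

/-- A pattern in the tree of a term: either a subtree pattern (a single node) or
a context pattern (a pair of a node and a proper descendant). -/
inductive PatternT : Type
  | subtree : List ℕ → PatternT
  | context : List ℕ → List ℕ → PatternT
deriving DecidableEq

/-- Validity of a pattern in the tree of the term `t`. -/
def PatternT.Valid {σ : Type} {ar : σ → ℕ} (t : RTerm σ ar) : PatternT → Prop
  | .subtree v => v ∈ t.pos
  | .context v w => v ∈ t.pos ∧ w ∈ t.pos ∧ v <+: w ∧ v ≠ w

/-- The set `V[p]` of nodes covered by a pattern. -/
def PatternT.cover {σ : Type} {ar : σ → ℕ} (t : RTerm σ ar) :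
    PatternT → Set (List ℕ)
  | .subtree v => {u | u ∈ t.pos ∧ v <+: u}
  | .context v w => {u | u ∈ t.pos ∧ v <+: u ∧ ¬ w <+: u}

/-- The root of a pattern. -/
def PatternT.root : PatternT → List ℕ
  | .subtree v => v
  | .context v _ => v

/-- `p` is a subtree pattern. -/
def PatternT.IsSubtree : PatternT → Prop
  | .subtree _ => True
  | .context _ _ => False

/-- A hierarchical definition of (the tree of) `t`: a well-nested set of valid
patterns containing the largest pattern (the root). -/
structure IsHierDef {σ : Type} {ar : σ → ℕ} (t : RTerm σ ar)
    (P : Finset PatternT) : Prop where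
  valid : ∀ p ∈ P, p.Valid t
  root_mem : PatternT.subtree ([] : List ℕ) ∈ P
  nested : ∀ p ∈ P, ∀ q ∈ P,
    Disjoint (p.cover t) (q.cover t) ∨ p.cover t ⊆ q.cover t ∨ q.cover t ⊆ p.cover t

/-- `q` is a direct subpattern of `p` with respect to `P`. -/
def DirectSub {σ : Type} {ar : σ → ℕ} (t : RTerm σ ar) (P : Finset PatternT)
    (q p : PatternT) : Prop :=
  q ∈ P ∧ p ∈ P ∧ q.cover t ⊂ p.cover t ∧
    ∀ r ∈ P, ¬ (q.cover t ⊂ r.cover t ∧ r.cover t ⊂ p.cover t)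

/-- The boundary `∂p`: the nodes covered by `p` but by no direct subpattern. -/
def boundary {σ : Type} {ar : σ → ℕ} (t : RTerm σ ar) (P : Finset PatternT)
    (p : PatternT) : Set (List ℕ) :=
  p.cover t \ ⋃ q ∈ {q | DirectSub t P q p}, q.cover t

/-- The depth of `P` (the height of its pattern tree) is at most `d`: every
strictly decreasing chain of patterns of `P` has at most `d + 1` elements. -/
def DepthLE {σ : Type} {ar : σ → ℕ} (t : RTerm σ ar) (P : Finset PatternT)
    (d : ℕ) : Prop :=
  ∀ c : List PatternT, (∀ p ∈ c, p ∈ P) →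
    c.Chain' (fun p q => q.cover t ⊂ p.cover t) → c.length ≤ d + 1

/-- The hierarchical definition `(T,P)` is in normal form: every pattern `p ∈ P`
either (1) has boundary exactly the root of `p` and all its direct subpatterns
are subtree patterns, or (2) has exactly two direct subpatterns whose covers
partition the cover of `p`. -/
def NormalForm {σ : Type} {ar : σ → ℕ} (t : RTerm σ ar) (P : Finset PatternT) :
    Prop :=
  ∀ p ∈ P,
    (boundary t P p = {p.root} ∧ ∀ q, DirectSub t P q p → q.IsSubtree) ∨
    (∃ p₁ p₂ : PatternT, p₁ ≠ p₂ ∧ DirectSub t P p₁ p ∧ DirectSub t P p₂ p ∧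
      (∀ q, DirectSub t P q p → q = p₁ ∨ q = p₂) ∧
      Disjoint (p₁.cover t) (p₂.cover t) ∧
      p.cover t = p₁.cover t ∪ p₂.cover t)

/-- Equivalence of two patterns `p₁, p₂ ∈ P`: a label- and order-preserving
isomorphism between `(T[p₁], P[p₁])` and `(T[p₂], P[p₂])`. -/
def Equivalent {σ : Type} {ar : σ → ℕ} (t : RTerm σ ar) (P : Finset PatternT)
    (p₁ p₂ : PatternT) : Prop :=
  ∃ φ : List ℕ → List ℕ,
    Set.BijOn φ (p₁.cover t) (p₂.cover t) ∧
    (∀ u ∈ p₁.cover t, t.labelAt (φ u) = t.labelAt u) ∧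
    (∀ u ∈ p₁.cover t, ∀ v ∈ p₁.cover t, ∀ i : ℕ,
       (v = u ++ [i] ↔ φ v = φ u ++ [i])) ∧
    (∀ q ∈ P, q.cover t ⊆ p₁.cover t →
       ∃ q' ∈ P, q'.cover t ⊆ p₂.cover t ∧ φ '' q.cover t = q'.cover t) ∧
    (∀ q' ∈ P, q'.cover t ⊆ p₂.cover t →
       ∃ q ∈ P, q.cover t ⊆ p₁.cover t ∧ φ '' q.cover t = q'.cover t)

/-- `P` has at most `m` pairwise inequivalent patterns. -/
def InequivLE {σ : Type} {ar : σ → ℕ} (t : RTerm σ ar) (P : Finset PatternT)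
    (m : ℕ) : Prop :=
  ∃ reps : Finset PatternT, reps ⊆ P ∧ reps.card ≤ m ∧
    ∀ p ∈ P, ∃ q ∈ reps, Equivalent t P p q

/-- Insert `x` at position `i` into an `(r-1)`-tuple, producing an `r`-tuple. -/
def plugAt {A : Type} {r : ℕ} (i : Fin r) (ts : Fin (r - 1) → A) (x : A)
    (j : Fin r) : A :=
  if h : (j : ℕ) < (i : ℕ) then ts ⟨j, by omega⟩
  else if h' : (j : ℕ) = (i : ℕ) then x
  else ts ⟨(j : ℕ) - 1, by have := j.isLt; omega⟩

/-- Plugging the term `s` into the hole of the context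
`f(t₁, …, t_{i-1}, x, t_i, …, t_{r-1})`. -/
def RTerm.plug {σ : Type} {ar : σ → ℕ} (f : σ) (i : Fin (ar f))
    (ts : Fin (ar f - 1) → RTerm σ ar) (s : RTerm σ ar) : RTerm σ ar :=
  RTerm.node f (plugAt i ts s)

/-- The right-hand side of a production of a tree straight-line program in
normal form over the nonterminal set `N`. -/
inductive Rhs (σ : Type) (ar : σ → ℕ) (N : Type) : Type
  | base0 (f : σ) (args : Fin (ar f) → N) : Rhs σ ar N
  | base1 (f : σ) (i : Fin (ar f)) (args : Fin (ar f - 1) → N) : Rhs σ ar N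
  | sub (B C : N) : Rhs σ ar N
  | comp (B C : N) : Rhs σ ar N

/-- `B` occurs in the right-hand side `r`. -/
def Rhs.Occurs {σ : Type} {ar : σ → ℕ} {N : Type} (B : N) : Rhs σ ar N → Prop
  | .base0 _ args => ∃ i, args i = B
  | .base1 _ _ args => ∃ i, args i = B
  | .sub B' C' => B = B' ∨ B = C'
  | .comp B' C' => B = B' ∨ B = C'

/-- The ranks of the nonterminals are respected by the production `A → r`. -/
def RankOk {σ : Type} {ar : σ → ℕ} {N : Type} (rank : N → Bool) (A : N) :
    Rhs σ ar N → Prop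
  | .base0 _ args => rank A = false ∧ ∀ i, rank (args i) = false
  | .base1 _ _ args => rank A = true ∧ ∀ i, rank (args i) = false
  | .sub B C => rank A = false ∧ rank B = true ∧ rank C = false
  | .comp B C => rank A = true ∧ rank B = true ∧ rank C = true

/-- The nonterminal values are consistent with the production `A → r`. -/
def ValOk {σ : Type} {ar : σ → ℕ} {N : Type}
    (val0 : N → RTerm σ ar) (val1 : N → RTerm σ ar → RTerm σ ar) (A : N) :
    Rhs σ ar N → Prop
  | .base0 f args => val0 A = RTerm.node f fun i => val0 (args i)
  | .base1 f i args => val1 A = RTerm.plug f i fun j => val0 (args j)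
  | .sub B C => val0 A = val1 B (val0 C)
  | .comp B C => val1 A = fun s => val1 B (val1 C s)

namespace HierTSLP

open Classical

variable {σ : Type} {ar : σ → ℕ}

/-- Replace the subterm at a position. -/
def repl : RTerm σ ar → List ℕ → RTerm σ ar → RTerm σ ar
  | _, [], s => s
  | .node f args, i :: l, s =>
    .node f fun j => if j.1 = i then repl (args j) l s else args j

theorem subAt_nil (t : RTerm σ ar) : t.subAt [] = some t := by
  cases t; rfl

theorem subAt_cons (f : σ) (a : Fin (ar f) → RTerm σ ar) (i : ℕ) (l : List ℕ) :
    (RTerm.node f a).subAt (i :: l) = if h : i < ar f then (a ⟨i, h⟩).subAt l else none := by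
  rw [RTerm.subAt]

theorem repl_nil (t s : RTerm σ ar) : repl t [] s = s := by
  cases t; rfl

theorem repl_cons (f : σ) (a : Fin (ar f) → RTerm σ ar) (i : ℕ) (l : List ℕ) (s : RTerm σ ar) :
    repl (RTerm.node f a) (i :: l) s =
      .node f fun j => if j.1 = i then repl (a j) l s else a j := by
  rw [repl]

theorem subAt_append (t : RTerm σ ar) (v l : List ℕ) :
    t.subAt (v ++ l) = (t.subAt v).bind (fun s => s.subAt l) := by
  induction v generalizing t with
  | nil => simp [subAt_nil]
  | cons i v ih =>
    cases t with
    | node f a =>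
      simp only [List.cons_append, subAt_cons]
      split <;> simp [ih]

theorem labelAt_nil (f : σ) (a : Fin (ar f) → RTerm σ ar) :
    (RTerm.node f a).labelAt [] = some f := by
  simp [RTerm.labelAt, subAt_nil]

theorem labelAt_cons (f : σ) (a : Fin (ar f) → RTerm σ ar) (i : ℕ) (l : List ℕ) :
    (RTerm.node f a).labelAt (i :: l) =
      if h : i < ar f then (a ⟨i, h⟩).labelAt l else none := by
  simp only [RTerm.labelAt, subAt_cons]
  split <;> simp

theorem labelAt_append (t s : RTerm σ ar) (v l : List ℕ) (h : t.subAt v = some s) :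
    t.labelAt (v ++ l) = s.labelAt l := by
  simp [RTerm.labelAt, subAt_append, h]

theorem labelAt_none (t : RTerm σ ar) (l : List ℕ) (h : l ∉ t.pos) : t.labelAt l = none := by
  simp [RTerm.pos] at h
  simp [RTerm.labelAt, h]

theorem mem_pos_append (t s : RTerm σ ar) (v l : List ℕ) (h : t.subAt v = some s) :
    v ++ l ∈ t.pos ↔ l ∈ s.pos := by
  simp [RTerm.pos, subAt_append, h]

theorem mem_pos_cons (f : σ) (a : Fin (ar f) → RTerm σ ar) (i : ℕ) (l : List ℕ) :
    i :: l ∈ (RTerm.node f a).pos ↔ ∃ h : i < ar f, l ∈ (a ⟨i, h⟩).pos := by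
  simp only [RTerm.pos, Set.mem_setOf_eq, subAt_cons]
  split <;> simp [*]

theorem nil_mem_pos (t : RTerm σ ar) : [] ∈ t.pos := by
  simp [RTerm.pos, subAt_nil]

theorem pos_of_pre (t : RTerm σ ar) {v w : List ℕ} (h : v <+: w) (hw : w ∈ t.pos) :
    v ∈ t.pos := by
  obtain ⟨l, rfl⟩ := h
  simp only [RTerm.pos, Set.mem_setOf_eq, subAt_append] at *
  cases h : t.subAt v <;> simp_all

theorem exists_subAt {t : RTerm σ ar} {v : List ℕ} (h : v ∈ t.pos) :
    ∃ s, t.subAt v = some s := Option.isSome_iff_exists.1 h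

theorem repl_append (t s : RTerm σ ar) (v l : List ℕ) (x : RTerm σ ar)
    (h : t.subAt v = some s) : repl t (v ++ l) x = repl t v (repl s l x) := by
  induction v generalizing t with
  | nil => simp [subAt_nil] at h; subst h; simp [repl_nil]
  | cons i v ih =>
    cases t with
    | node f a =>
      rw [subAt_cons] at h
      simp only [List.cons_append, repl_cons]
      congr 1
      funext j
      split
      · rename_i hj
        subst hj
        simp only [j.2, dite_true] at h
        exact ih _ h
      · rfl

theorem repl_self (t s : RTerm σ ar) (v : List ℕ) (h : t.subAt v = some s) :
    repl t v s = t := by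
  induction v generalizing t with
  | nil => simp [subAt_nil] at h; subst h; simp [repl_nil]
  | cons i v ih =>
    cases t with
    | node f a =>
      rw [subAt_cons] at h
      simp only [repl_cons]
      congr 1
      funext j
      split
      · rename_i hj
        subst hj
        simp only [j.2, dite_true] at h
        exact ih _ h
      · rfl

theorem ext_full (s₁ s₂ : RTerm σ ar) (h : ∀ l, s₁.labelAt l = s₂.labelAt l) : s₁ = s₂ := by
  induction s₁ generalizing s₂ with
  | node f a ih =>
    cases s₂ with
    | node g b =>
      have h0 := h []
      simp only [labelAt_nil, Option.some.injEq] at h0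
      subst h0
      congr 1
      funext j
      apply ih
      intro l
      have := h (j.1 :: l)
      simpa [labelAt_cons] using this

theorem mixed (k : List ℕ) (s₁ s₂ : RTerm σ ar) (hk : k ∈ s₂.pos)
    (h : ∀ l, s₁.labelAt l = if k <+: l then none else s₂.labelAt l) : False := by
  induction k generalizing s₁ s₂ with
  | nil =>
    have := h []
    cases s₁
    simp [labelAt_nil] at this
  | cons i k ih =>
    cases s₁ with
    | node f a =>
    cases s₂ with
    | node g b =>
      have h0 := h []
      simp only [labelAt_nil] at h0
      simp at h0
      subst h0
      obtain ⟨hi, hk⟩ := (mem_pos_cons _ _ _ _).1 hk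
      refine ih (a ⟨i, hi⟩) (b ⟨i, hi⟩) hk ?_
      intro l
      have := h (i :: l)
      simpa [labelAt_cons, hi] using this

theorem ext_ctx (k₁ k₂ : List ℕ) (s₁ s₂ : RTerm σ ar) (hk₁ : k₁ ∈ s₁.pos) (hk₂ : k₂ ∈ s₂.pos)
    (h : ∀ l, (if k₁ <+: l then none else s₁.labelAt l) =
      if k₂ <+: l then none else s₂.labelAt l) : repl s₁ k₁ = repl s₂ k₂ := by
  induction k₁ generalizing s₁ s₂ k₂ with
  | nil =>
    cases k₂ with
    | nil => funext x; simp [repl_nil]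
    | cons j k =>
      have := h []
      cases s₂
      simp [labelAt_nil] at this
  | cons i k₁ ih =>
    cases k₂ with
    | nil =>
      have := h []
      cases s₁
      simp [labelAt_nil] at this
    | cons j k₂ =>
    cases s₁ with
    | node f a =>
    cases s₂ with
    | node g b =>
      have h0 := h []
      simp only [labelAt_nil] at h0
      simp at h0
      subst h0
      obtain ⟨hi, hk₁⟩ := (mem_pos_cons _ _ _ _).1 hk₁
      obtain ⟨hj, hk₂⟩ := (mem_pos_cons _ _ _ _).1 hk₂
      by_cases hij : i = j
      · subst hij
        funext x
        rw [repl_cons, repl_cons]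
        congr 1
        funext c
        split
        · rename_i hc
          subst hc
          refine congrFun (ih k₂ _ _ hk₁ hk₂ ?_) x
          intro l
          have := h (c.1 :: l)
          simpa [labelAt_cons] using this
        · rename_i hc
          apply ext_full
          intro l
          have := h (c.1 :: l)
          simpa [labelAt_cons, Ne.symm hc] using this
      · exfalso
        refine mixed k₂ (a ⟨j, hj⟩) (b ⟨j, hj⟩) hk₂ ?_
        intro l
        have := h (j :: l)
        simpa [labelAt_cons, hij, hj] using this

/-! ### Patterns -/

theorem root_mem_cover {t : RTerm σ ar} {p : PatternT} (h : p.Valid t) :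
    p.root ∈ p.cover t := by
  cases p with
  | subtree v => exact ⟨h, List.prefix_rfl⟩
  | context v w =>
    obtain ⟨h1, h2, h3, h4⟩ := h
    refine ⟨h1, List.prefix_rfl, fun h => h4 ?_⟩
    exact h3.eq_of_length_le h.length_le

theorem cover_root {t : RTerm σ ar} {p : PatternT} {u : List ℕ} (h : u ∈ p.cover t) :
    p.root <+: u := by
  cases p with
  | subtree v => exact h.2
  | context v w => exact h.2.1

theorem cover_pos {t : RTerm σ ar} {p : PatternT} {u : List ℕ} (h : u ∈ p.cover t) :
    u ∈ t.pos := by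
  cases p with
  | subtree v => exact h.1
  | context v w => exact h.1

theorem cover_pred {t : RTerm σ ar} {p : PatternT} {u v : List ℕ} (h : u ∈ p.cover t)
    (hv : p.root <+: v) (hvu : v <+: u) : v ∈ p.cover t := by
  cases p with
  | subtree r => exact ⟨pos_of_pre t hvu h.1, hv⟩
  | context r w => exact ⟨pos_of_pre t hvu h.1, hv, fun hw => h.2.2 (hw.trans hvu)⟩

/-- relative labelling of a pattern -/
noncomputable def relLbl (t : RTerm σ ar) (p : PatternT) (l : List ℕ) : Option σ :=
  if p.root ++ l ∈ p.cover t then t.labelAt (p.root ++ l) else none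

theorem equiv_relLbl {t : RTerm σ ar} {P : Finset PatternT} {p q : PatternT}
    (hp : p.Valid t) (hq : q.Valid t) (h : Equivalent t P p q) (l : List ℕ) :
    relLbl t p l = relLbl t q l := by
  obtain ⟨φ, hb, hl, hc, -, -⟩ := h
  have hroot : φ p.root = q.root := by
    obtain ⟨u, hu, hφ⟩ := hb.surjOn (root_mem_cover hq)
    obtain ⟨l, rfl⟩ := cover_root hu
    rcases List.eq_nil_or_concat l with rfl | ⟨l', i, rfl⟩
    · simpa using hφ
    · exfalso
      have hu' : p.root ++ l' ∈ p.cover t :=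
        cover_pred hu (List.prefix_append _ _) ⟨[i], by simp⟩
      have h1 := (hc _ hu' _ hu i).1 (by simp)
      have h2 := (cover_root (hb.mapsTo hu')).length_le
      rw [hφ] at h1
      rw [h1] at h2
      simp at h2
  have key : ∀ l, p.root ++ l ∈ p.cover t → φ (p.root ++ l) = q.root ++ l := by
    intro l
    induction l using List.reverseRecOn with
    | nil => simpa using fun _ => hroot
    | append_singleton l' i ih =>
      intro hu
      have hu' : p.root ++ l' ∈ p.cover t :=
        cover_pred hu (List.prefix_append _ _) ⟨[i], by simp⟩
      have h1 := (hc _ hu' _ hu i).1 (by simp)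
      rw [h1, ih hu']
      simp
  unfold relLbl
  by_cases h1 : p.root ++ l ∈ p.cover t
  · have h2 := hb.mapsTo h1
    have h3 := hl _ h1
    rw [key l h1] at h2 h3
    rw [if_pos h1, if_pos h2, h3]
  · have h2 : q.root ++ l ∉ q.cover t := by
      intro h2
      obtain ⟨u, hu, hφ⟩ := hb.surjOn h2
      obtain ⟨l', rfl⟩ := cover_root hu
      rw [key _ hu] at hφ
      rw [List.append_cancel_left hφ] at hu
      exact h1 hu
    rw [if_neg h1, if_neg h2]

theorem relLbl_subtree {t s : RTerm σ ar} {v : List ℕ} (h : t.subAt v = some s) (l : List ℕ) :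
    relLbl t (.subtree v) l = s.labelAt l := by
  unfold relLbl
  simp only [PatternT.root, PatternT.cover, Set.mem_setOf_eq, List.prefix_append, and_true,
    mem_pos_append t s v l h, labelAt_append t s v l h]
  split
  · rfl
  · rw [labelAt_none]; assumption

theorem relLbl_context {t s : RTerm σ ar} {v k : List ℕ} (h : t.subAt v = some s) (l : List ℕ) :
    relLbl t (.context v (v ++ k)) l = if k <+: l then none else s.labelAt l := by
  unfold relLbl
  simp only [PatternT.root, PatternT.cover, Set.mem_setOf_eq, List.prefix_append, true_and,
    mem_pos_append t s v l h, labelAt_append t s v l h, List.prefix_append_right_inj]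
  by_cases h1 : k <+: l
  · simp [h1]
  · simp only [h1, not_false_eq_true, and_true, if_false]
    split
    · rfl
    · rw [labelAt_none]; assumption

/-- rank of a pattern -/
def rk : PatternT → Bool
  | .subtree _ => false
  | .context _ _ => true

/-- value of a subtree pattern -/
def v0 (t : RTerm σ ar) : PatternT → RTerm σ ar
  | .subtree v => (t.subAt v).getD t
  | .context _ _ => t

/-- value of a context pattern -/
def v1 (t : RTerm σ ar) : PatternT → RTerm σ ar → RTerm σ ar
  | .subtree _ => id
  | .context v w => repl ((t.subAt v).getD t) (w.drop v.length)

theorem equiv_vals {t : RTerm σ ar} {P : Finset PatternT} {p q : PatternT}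
    (hp : p.Valid t) (hq : q.Valid t) (h : Equivalent t P p q) :
    rk p = rk q ∧ v0 t p = v0 t q ∧ v1 t p = v1 t q := by
  have hl := equiv_relLbl hp hq h
  cases p with
  | subtree v =>
    obtain ⟨s, hs⟩ := exists_subAt hp
    cases q with
    | subtree v' =>
      obtain ⟨s', hs'⟩ := exists_subAt hq
      simp only [relLbl_subtree hs, relLbl_subtree hs'] at hl
      simp [rk, v0, v1, hs, hs', ext_full _ _ hl]
    | context v' w' =>
      obtain ⟨h1, h2, ⟨k, rfl⟩, h4⟩ := hq
      obtain ⟨s', hs'⟩ := exists_subAt h1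
      simp only [relLbl_subtree hs, relLbl_context hs'] at hl
      exact (mixed k s s' ((mem_pos_append _ _ _ _ hs').1 h2) hl).elim
  | context v w =>
    obtain ⟨h1, h2, ⟨k, rfl⟩, h4⟩ := hp
    obtain ⟨s, hs⟩ := exists_subAt h1
    cases q with
    | subtree v' =>
      obtain ⟨s', hs'⟩ := exists_subAt hq
      simp only [relLbl_subtree hs', relLbl_context hs] at hl
      exact (mixed k s' s ((mem_pos_append _ _ _ _ hs).1 h2) (fun l => (hl l).symm)).elim
    | context v' w' =>
      obtain ⟨h1', h2', ⟨k', rfl⟩, h4'⟩ := hq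
      obtain ⟨s', hs'⟩ := exists_subAt h1'
      simp only [relLbl_context hs', relLbl_context hs] at hl
      have := ext_ctx k k' s s' ((mem_pos_append _ _ _ _ hs).1 h2)
        ((mem_pos_append _ _ _ _ hs').1 h2') hl
      simp [rk, v0, v1, hs, hs', this]

/-! ### Heights -/

/-- there is a chain of length `n + 1` below `p` -/
def Below (t : RTerm σ ar) (P : Finset PatternT) (p : PatternT) (n : ℕ) : Prop :=
  ∃ c : List PatternT, c.length = n + 1 ∧ (∀ q ∈ c, q ∈ P ∧ q.cover t ⊆ p.cover t) ∧
    c.IsChain (fun p q => q.cover t ⊂ p.cover t)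

theorem below_zero {t : RTerm σ ar} {P : Finset PatternT} {p : PatternT} (hp : p ∈ P) :
    Below t P p 0 := ⟨[p], rfl, by simp [hp], by simp⟩

theorem below_succ {t : RTerm σ ar} {P : Finset PatternT} {p q : PatternT} {n : ℕ} (hp : p ∈ P)
    (hqp : q.cover t ⊂ p.cover t) (h : Below t P q n) : Below t P p (n + 1) := by
  obtain ⟨c, hl, hc, hch⟩ := h
  cases c with
  | nil => simp at hl
  | cons a c =>
    refine ⟨p :: a :: c, by simpa using hl, ?_, ?_⟩
    · intro r hr
      rcases List.mem_cons.1 hr with rfl | hr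
      · exact ⟨hp, subset_rfl⟩
      · exact ⟨(hc r hr).1, (hc r hr).2.trans hqp.1⟩
    · rw [List.isChain_cons_cons]
      exact ⟨lt_of_le_of_lt (hc a (by simp)).2 hqp, hch⟩

theorem below_le {t : RTerm σ ar} {P : Finset PatternT} {p : PatternT} {n d : ℕ}
    (hd : DepthLE t P d) (h : Below t P p n) : n ≤ d := by
  obtain ⟨c, hl, hc, hch⟩ := h
  have := hd c (fun q hq => (hc q hq).1) hch
  omega

theorem below_equiv {t : RTerm σ ar} {P : Finset PatternT} {p q : PatternT} {n : ℕ}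
    (h : Equivalent t P p q) (hb : Below t P q n) : Below t P p n := by
  obtain ⟨φ, hbij, -, -, -, hs⟩ := h
  obtain ⟨c, hl, hc, hch⟩ := hb
  choose! g hg1 hg2 hg3 using hs
  refine ⟨c.map g, by simpa using hl, ?_, ?_⟩
  · intro r hr
    obtain ⟨r', hr', rfl⟩ := List.mem_map.1 hr
    exact ⟨hg1 _ (hc _ hr').1 (hc _ hr').2, hg2 _ (hc _ hr').1 (hc _ hr').2⟩
  · rw [List.isChain_map]
    refine List.IsChain.imp_of_mem_imp ?_ hch
    intro a b ha hb hab
    obtain ⟨a1, a2⟩ := hc a ha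
    obtain ⟨b1, b2⟩ := hc b hb
    rw [← hg3 a a1 a2, ← hg3 b b1 b2] at hab
    have hsub : (g b).cover t ⊆ (g a).cover t := by
      exact (hbij.injOn.image_subset_image_iff (hg2 b b1 b2) (hg2 a a1 a2)).1 hab.1
    exact ⟨hsub, fun hh => hab.2 (Set.image_mono hh)⟩

/-- height of a pattern -/
noncomputable def ht (t : RTerm σ ar) (P : Finset PatternT) (d : ℕ) (p : PatternT) : ℕ :=
  Nat.findGreatest (Below t P p) d

theorem ht_le (t : RTerm σ ar) (P : Finset PatternT) (d : ℕ) (p : PatternT) :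
    ht t P d p ≤ d := Nat.findGreatest_le d

theorem ht_lt {t : RTerm σ ar} {P : Finset PatternT} {p q r : PatternT} {d : ℕ}
    (hd : DepthLE t P d) (hp : p ∈ P) (hr : r ∈ P)
    (hqp : q.cover t ⊂ p.cover t) (he : Equivalent t P q r) :
    ht t P d r < ht t P d p := by
  have h1 : Below t P r (ht t P d r) :=
    Nat.findGreatest_spec (P := Below t P r) (Nat.zero_le d) (below_zero hr)
  have h2 := below_succ hp hqp (below_equiv he h1)
  exact Nat.le_findGreatest (below_le hd h2) h2

/-! ### Decomposition -/

theorem child_mem {t : RTerm σ ar} {P : Finset PatternT} {p : PatternT} (hH : IsHierDef t P)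
    (hb : boundary t P p = {p.root}) (hs : ∀ q, DirectSub t P q p → q.IsSubtree)
    {i : ℕ} (hi : p.root ++ [i] ∈ p.cover t) :
    DirectSub t P (.subtree (p.root ++ [i])) p := by
  have h1 : p.root ++ [i] ∉ boundary t P p := by
    rw [hb]; simp
  have h2 : p.root ∈ boundary t P p := by rw [hb]; simp
  unfold boundary at h1 h2
  simp only [Set.mem_diff, hi, true_and, not_not, Set.mem_iUnion, Set.mem_setOf_eq,
    exists_prop] at h1
  obtain ⟨q, hq, hu⟩ := h1
  have h3 : p.root ∉ q.cover t := by
    intro h3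
    apply h2.2
    simp only [Set.mem_iUnion, Set.mem_setOf_eq, exists_prop]
    exact ⟨q, hq, h3⟩
  have hsub := hs q hq
  cases q with
  | context _ _ => exact hsub.elim
  | subtree r =>
    have hr := root_mem_cover (hH.valid _ hq.1)
    have h4 := cover_root (hq.2.2.1.1 hr)
    have h5 : r <+: p.root ++ [i] := hu.2
    rcases List.prefix_concat_iff.1 h5 with h6 | h6
    · subst h6; exact hq
    · exact (h3 (cover_pred hu h6 (List.prefix_append _ _))).elim

theorem prefix_antisymm {a b : List ℕ} (h : a <+: b) (h' : b <+: a) : a = b :=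
  h.eq_of_length_le h'.length_le

theorem split_two {t : RTerm σ ar} {p p₁ p₂ : PatternT}
    (hp : p.Valid t) (hp₁ : p₁.Valid t) (hp₂ : p₂.Valid t)
    (h₁ : p₁.cover t ⊂ p.cover t)
    (hdis : Disjoint (p₁.cover t) (p₂.cover t)) (hun : p.cover t = p₁.cover t ∪ p₂.cover t)
    (hroot : p.root ∈ p₁.cover t) :
    (∃ v w, p = .subtree v ∧ p₁ = .context v w ∧ p₂ = .subtree w) ∨
    (∃ v w w', p = .context v w ∧ p₁ = .context v w' ∧ p₂ = .context w' w) := by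
  have hr1 : p₁.root = p.root :=
    prefix_antisymm (cover_root hroot) (cover_root (h₁.1 (root_mem_cover hp₁)))
  have hin : ∀ u, u ∈ p.cover t → u ∉ p₁.cover t → u ∈ p₂.cover t := by
    intro u hu hu1
    rw [hun] at hu
    exact hu.resolve_left hu1
  have hr2 := root_mem_cover hp₂
  have hr2p : p₂.root ∈ p.cover t := by rw [hun]; exact Or.inr hr2
  have hr2n : p₂.root ∉ p₁.cover t := fun h => Set.disjoint_left.1 hdis h hr2
  cases p with
  | subtree v =>
    left
    cases p₁ with
    | subtree v' =>
      simp only [PatternT.root] at hr1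
      subst hr1
      exact (h₁.2 subset_rfl).elim
    | context v' w =>
      simp only [PatternT.root] at hr1
      subst hr1
      obtain ⟨a1, a2, a3, a4⟩ := hp₁
      have hw2 : w ∈ p₂.cover t := hin w ⟨a2, a3⟩ (fun h => h.2.2 List.prefix_rfl)
      have hwr : w <+: p₂.root := by
        by_contra hc
        exact hr2n ⟨hr2p.1, hr2p.2, hc⟩
      have hrw := prefix_antisymm (cover_root hw2) hwr
      cases p₂ with
      | subtree w' =>
        simp only [PatternT.root] at hrw
        subst hrw
        exact ⟨_, _, rfl, rfl, rfl⟩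
      | context w' w₂ =>
        simp only [PatternT.root] at hrw
        subst hrw
        exfalso
        obtain ⟨b1, b2, b3, b4⟩ := hp₂
        have := hin w₂ ⟨b2, a3.trans b3⟩ (fun h => h.2.2 b3)
        exact this.2.2 List.prefix_rfl
  | context v w =>
    right
    obtain ⟨c1, c2, c3, c4⟩ := hp
    have hwn : w ∉ (PatternT.context v w).cover t := fun h => h.2.2 List.prefix_rfl
    cases p₁ with
    | subtree v' =>
      simp only [PatternT.root] at hr1
      subst hr1
      exact (hwn (h₁.1 ⟨c2, c3⟩)).elim
    | context v' w' =>
      simp only [PatternT.root] at hr1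
      subst hr1
      obtain ⟨a1, a2, a3, a4⟩ := hp₁
      have hw'w : w' <+: w := by
        by_contra hc
        exact hwn (h₁.1 ⟨c2, c3, hc⟩)
      have hne : w' ≠ w := by
        rintro rfl
        exact h₁.2 subset_rfl
      have hww' : ¬ w <+: w' := fun h => hne (prefix_antisymm hw'w h)
      have hw2 : w' ∈ p₂.cover t := hin w' ⟨a2, a3, hww'⟩ (fun h => h.2.2 List.prefix_rfl)
      have hwr : w' <+: p₂.root := by
        by_contra hc
        exact hr2n ⟨hr2p.1, hr2p.2.1, hc⟩
      have hrw := prefix_antisymm (cover_root hw2) hwr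
      cases p₂ with
      | subtree r =>
        simp only [PatternT.root] at hrw
        subst hrw
        exact (hwn (hun ▸ Or.inr ⟨c2, hw'w⟩)).elim
      | context r w₂ =>
        simp only [PatternT.root] at hrw
        subst hrw
        obtain ⟨b1, b2, b3, b4⟩ := hp₂
        have h2w : w₂ <+: w := by
          by_contra hc
          exact hwn (hun ▸ Or.inr ⟨c2, hw'w, hc⟩)
        have : w₂ = w := by
          by_contra hc
          have := hin w₂ ⟨b2, a3.trans b3, fun h => hc (prefix_antisymm h2w h)⟩
            (fun h => h.2.2 b3)
          exact this.2.2 List.prefix_rfl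
        subst this
        exact ⟨_, _, _, rfl, rfl, rfl⟩

/-- skip the hole index -/
def skipIdx {r : ℕ} (i : Fin r) (j : Fin (r - 1)) : Fin r :=
  if j.1 < i.1 then ⟨j.1, by omega⟩ else ⟨j.1 + 1, by omega⟩

theorem skip_ne {r : ℕ} (i : Fin r) (j : Fin (r - 1)) : (skipIdx i j).1 ≠ i.1 := by
  unfold skipIdx
  split <;> simp <;> omega

theorem plugAt_skip {A : Type} {r : ℕ} (i : Fin r) (a : Fin r → A) (x : A) :
    plugAt i (fun j => a (skipIdx i j)) x = fun j => if j.1 = i.1 then x else a j := by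
  funext j
  unfold plugAt
  split
  · rename_i h
    rw [if_neg (by omega)]
    congr 1
    unfold skipIdx
    simp [h]
  · split
    · rfl
    · congr 1
      unfold skipIdx
      have : ¬ (j.1 - 1 < i.1) := by omega
      simp only [this, if_false]
      congr 1
      apply Fin.ext
      simp only
      omega

theorem production {t : RTerm σ ar} {P reps : Finset PatternT} {d : ℕ}
    (hH : IsHierDef t P) (hN : NormalForm t P) (hd : DepthLE t P d) (hreps : reps ⊆ P)
    (R : PatternT → {x // x ∈ reps}) (hR : ∀ p ∈ P, Equivalent t P p (R p).1)
    (p : PatternT) (hp : p ∈ P) (A : {x // x ∈ reps}) (hA : A.1 = p) :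
    ∃ r : Rhs σ ar {x // x ∈ reps},
      RankOk (fun B => rk B.1) A r ∧
      (∀ B, r.Occurs B → ht t P d B.1 < ht t P d A.1) ∧
      ValOk (fun B => v0 t B.1) (fun B => v1 t B.1) A r := by
  have hv := hH.valid p hp
  have hRP : ∀ q, (R q).1 ∈ P := fun q => hreps (R q).2
  have hRv : ∀ q ∈ P, rk q = rk (R q).1 ∧ v0 t q = v0 t (R q).1 ∧ v1 t q = v1 t (R q).1 :=
    fun q hq => equiv_vals (hH.valid q hq) (hH.valid _ (hRP q)) (hR q hq)
  have hRh : ∀ q, DirectSub t P q p → ht t P d (R q).1 < ht t P d p := fun q hq =>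
    ht_lt hd hp (hRP q) hq.2.2.1 (hR q hq.1)
  rcases hN p hp with ⟨hb, hs⟩ | ⟨p₁, p₂, -, hd₁, hd₂, -, hdis, hun⟩
  · have hch := fun i => child_mem hH hb hs (i := i)
    cases p with
    | subtree v =>
      obtain ⟨s, hsv⟩ := exists_subAt hv
      cases s with
      | node f a =>
        have hc : ∀ i : Fin (ar f), DirectSub t P (.subtree (v ++ [i.1])) (.subtree v) := by
          intro i
          refine hch i.1 ⟨?_, List.prefix_append _ _⟩
          rw [PatternT.root, mem_pos_append _ _ _ _ hsv, mem_pos_cons]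
          exact ⟨i.2, nil_mem_pos _⟩
        refine ⟨.base0 f fun i => R (.subtree (v ++ [i.1])), ?_, ?_, ?_⟩
        · refine ⟨by simp only [hA]; rfl, fun i => ?_⟩
          exact ((hRv _ (hc i).1).1).symm
        · rintro B ⟨i, rfl⟩
          rw [hA]
          exact hRh _ (hc i)
        · simp only [ValOk, hA]
          simp only [v0, hsv, Option.getD_some]
          congr 1
          funext i
          rw [← v0.eq_def, ← (hRv _ (hc i).1).2.1]
          simp [v0, subAt_append, hsv, subAt_cons, subAt_nil]
    | context v w =>
      obtain ⟨h1, h2, ⟨k, rfl⟩, h4⟩ := hv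
      obtain ⟨s, hsv⟩ := exists_subAt h1
      cases s with
      | node f a =>
        cases k with
        | nil => simp at h4
        | cons i k =>
          have hk : k = [] := by
            by_contra hk
            have hin : v ++ [i] ∈ (PatternT.context v (v ++ i :: k)).cover t := by
              refine ⟨pos_of_pre t ⟨k, by simp⟩ h2, List.prefix_append _ _, fun h => hk ?_⟩
              have := h.length_le
              simp at this
              exact this
            have hD := hch i hin
            have : v ++ i :: k ∈ (PatternT.context v (v ++ i :: k)).cover t :=
              hD.2.2.1.1 ⟨h2, ⟨k, by simp [PatternT.root]⟩⟩
            exact this.2.2 List.prefix_rfl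
          subst hk
          obtain ⟨hi, -⟩ := (mem_pos_cons _ _ _ _).1 ((mem_pos_append _ _ _ _ hsv).1 h2)
          have hc : ∀ j : Fin (ar f), j.1 ≠ i →
              DirectSub t P (.subtree (v ++ [j.1])) (.context v (v ++ [i])) := by
            intro j hj
            refine hch j.1 ⟨?_, List.prefix_append _ _, ?_⟩
            · rw [PatternT.root, mem_pos_append _ _ _ _ hsv, mem_pos_cons]
              exact ⟨j.2, nil_mem_pos _⟩
            · intro h
              rw [PatternT.root, List.prefix_append_right_inj] at h
              simp at h
              exact hj h.symm
          refine ⟨.base1 f ⟨i, hi⟩ fun j => R (.subtree (v ++ [(skipIdx ⟨i, hi⟩ j).1])), ?_, ?_, ?_⟩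
          · refine ⟨by simp only [hA]; rfl, fun j => ?_⟩
            exact ((hRv _ (hc _ (skip_ne ⟨i, hi⟩ j)).1).1).symm
          · rintro B ⟨j, rfl⟩
            rw [hA]
            exact hRh _ (hc _ (skip_ne ⟨i, hi⟩ j))
          · simp only [ValOk, hA]
            have hval : (fun j => v0 t (R (.subtree (v ++ [(skipIdx ⟨i, hi⟩ j).1]))).1) =
                fun j => a (skipIdx ⟨i, hi⟩ j) := by
              funext j
              rw [← (hRv _ (hc _ (skip_ne ⟨i, hi⟩ j)).1).2.1]
              simp [v0, subAt_append, hsv, subAt_cons, subAt_nil]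
            rw [hval]
            funext x
            rw [RTerm.plug, plugAt_skip]
            simp [v1, hsv, repl_cons, repl_nil]
  · wlog hroot : p.root ∈ p₁.cover t generalizing p₁ p₂
    · refine this p₂ p₁ hd₂ hd₁ hdis.symm (by rw [hun, Set.union_comm]) ?_
      have := root_mem_cover hv
      rw [hun] at this
      exact this.resolve_left hroot
    have hv₁ := hH.valid _ hd₁.1
    have hv₂ := hH.valid _ hd₂.1
    have e₁ := hRv _ hd₁.1
    have e₂ := hRv _ hd₂.1
    have l₁ := hRh _ hd₁
    have l₂ := hRh _ hd₂
    rcases split_two hv hv₁ hv₂ hd₁.2.2.1 hdis hun hroot with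
      ⟨v, w, rfl, rfl, rfl⟩ | ⟨v, w, w', rfl, rfl, rfl⟩
    · refine ⟨.sub (R (.context v w)) (R (.subtree w)), ?_, ?_, ?_⟩
      · exact ⟨by simp only [hA]; rfl, e₁.1.symm, e₂.1.symm⟩
      · rintro B (rfl | rfl) <;> rw [hA] <;> assumption
      · simp only [ValOk, hA]
        rw [← e₁.2.2, ← e₂.2.1]
        obtain ⟨h1, h2, ⟨k, rfl⟩, h4⟩ := hv₁
        obtain ⟨s, hsv⟩ := exists_subAt h1
        obtain ⟨s', hsw⟩ := exists_subAt h2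
        simp only [v0, v1, hsv, hsw, Option.getD_some, List.drop_left]
        rw [repl_self]
        rw [subAt_append, hsv] at hsw
        exact hsw
    · refine ⟨.comp (R (.context v w')) (R (.context w' w)), ?_, ?_, ?_⟩
      · exact ⟨by simp only [hA]; rfl, e₁.1.symm, e₂.1.symm⟩
      · rintro B (rfl | rfl) <;> rw [hA] <;> assumption
      · simp only [ValOk, hA]
        rw [← e₁.2.2, ← e₂.2.2]
        obtain ⟨h1, h2, ⟨k, rfl⟩, h4⟩ := hv₁
        obtain ⟨-, h2', ⟨k', rfl⟩, h4'⟩ := hv₂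
        obtain ⟨s, hsv⟩ := exists_subAt h1
        obtain ⟨s', hsw⟩ := exists_subAt h2
        simp only [v1, hsv, hsw, Option.getD_some, List.drop_left, List.append_assoc]
        rw [← List.append_assoc, List.drop_left]
        funext x
        rw [subAt_append, hsv] at hsw
        exact repl_append s s' k k' x hsw

end HierTSLP

/-- **From hierarchical definitions to TSLPs**: for every ranked alphabet `Σ`
there is a constant `C` such that if `t ∈ T(Σ)` is a term and `(T,P)` is a
hierarchical definition in normal form of the `Σ`-labelled tree `T`
corresponding to `t`, where `P` has depth `d` and `m` pairwise inequivalent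
patterns, then there exists a tree straight-line program `G` over `Σ` in normal
form with `val(G) = t`, of size at most `C·m` and depth at most `C·d`. -/
theorem stmt19 (σ : Type) (ar : σ → ℕ) [Fintype σ] :
    ∃ C : ℕ, 0 < C ∧
      ∀ (t : RTerm σ ar) (P : Finset PatternT) (d m : ℕ),
        IsHierDef t P → NormalForm t P → DepthLE t P d → InequivLE t P m →
        ∃ (N : Type) (_ : Fintype N) (rank : N → Bool) (S : N)
          (rhs : N → Rhs σ ar N) (val0 : N → RTerm σ ar)
          (val1 : N → RTerm σ ar → RTerm σ ar) (dp : N → ℕ),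
          rank S = false ∧
          (∀ A, RankOk rank A (rhs A)) ∧
          (∀ A B, (rhs A).Occurs B → dp B < dp A) ∧
          (∀ A, dp A ≤ C * d) ∧
          (∀ A, ValOk val0 val1 A (rhs A)) ∧
          Fintype.card N ≤ C * m ∧
          val0 S = t := by
  refine ⟨1, one_pos, ?_⟩
  intro t P d m hH hN hd hm
  obtain ⟨reps, hsub, hcard, hrep⟩ := hm
  obtain ⟨q0, hq0, -⟩ := hrep _ hH.root_mem
  have hex : ∀ p, ∃ q : {x // x ∈ reps}, p ∈ P → Equivalent t P p q.1 := by
    intro p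
    by_cases hp : p ∈ P
    · obtain ⟨q, hq, he⟩ := hrep p hp
      exact ⟨⟨q, hq⟩, fun _ => he⟩
    · exact ⟨⟨q0, hq0⟩, fun h => absurd h hp⟩
  choose R hR using hex
  choose rhs h1 h2 h3 using fun A : {x // x ∈ reps} =>
    HierTSLP.production hH hN hd hsub R hR A.1 (hsub A.2) A rfl
  have hS := HierTSLP.equiv_vals (hH.valid _ hH.root_mem) (hH.valid _ (hsub (R _).2))
    (hR _ hH.root_mem)
  refine ⟨{x // x ∈ reps}, inferInstance, fun B => HierTSLP.rk B.1, R (.subtree []), rhs,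
    fun B => HierTSLP.v0 t B.1, fun B => HierTSLP.v1 t B.1,
    fun B => HierTSLP.ht t P d B.1, hS.1.symm, h1, h2, ?_, h3, ?_, ?_⟩
  · intro A
    rw [one_mul]
    exact HierTSLP.ht_le t P d A.1
  · simpa using hcard
  · refine hS.2.1.symm.trans ?_
    simp [HierTSLP.v0, HierTSLP.subAt_nil]
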